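/- The smallest subset of Q containing {a, b, c} and closed under the six maps x ↦ x ▷ a, x ▷ b, x ▷ c, x ▷⁻¹ a, x ▷⁻¹ b, x ▷⁻¹ c has at most 18(2k-1) + 8 elements. (This is the upper-bound half of the theorem that |Q_{(2,3)}(M_k)| = 18|2k-1| + 8.) -/

import Mathlib

/-- A quandle in the paper's (right-action) conventions: `op x y` is `x ▷ y` (written `x^y`)
and `inv x y` is `x ▷⁻¹ y` (written `x^{ȳ}`). -/
structure LinkQuandle (Q : Type*) where
  op : Q → Q → Q
  inv : Q → Q → Q
  idem : ∀ x, op x x = x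
  inv_op : ∀ x y, inv (op x y) y = x
  op_inv : ∀ x y, op (inv x y) y = x
  distrib : ∀ x y z, op (op x y) z = op (op x z) (op y z)

/-- `opPow q y n x` is `x^{yⁿ}`: act on `x` by `y`, `n` times. -/
def LinkQuandle.opPow {Q : Type*} (q : LinkQuandle Q) (y : Q) (n : ℕ) (x : Q) : Q :=
  (fun z => q.op z y)^[n] x

/-- `pairPow q y z t x` is `x^{(yz)^t}`: act on `x` by `y` then `z`, `t` times. -/
def LinkQuandle.pairPow {Q : Type*} (q : LinkQuandle Q) (y z : Q) (t : ℕ) (x : Q) : Q :=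
  (fun w => q.op (q.op w y) z)^[t] x

/-- The smallest subset of `Q` containing `S` and closed under acting (and inversely acting)
by every element of `S`. -/
def LinkQuandle.genClosure {Q : Type*} (q : LinkQuandle Q) (S : Set Q) : Set Q :=
  ⋂₀ {T : Set Q | S ⊆ T ∧ ∀ x ∈ T, ∀ s ∈ S, q.op x s ∈ T ∧ q.inv x s ∈ T}

section GroupAction

variable {G X : Type*} [Group G] [MulAction G X] {A C T P : G} {n : ℕ}

theorem commute_twist (hCT : Commute C T) (hAT : A * T = T⁻¹ * A)
    (hP : P = C * A * C⁻¹ * A) : Commute P T := by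
  have hAT' : SemiconjBy A T T⁻¹ := hAT
  have hTA : SemiconjBy A T⁻¹ T := by simpa using hAT'.inv_right
  rw [hP]
  exact ((SemiconjBy.mul_left hCT hTA).mul_left hCT.inv_left.inv_right).mul_left hAT'

theorem twist_swap (hA : A * A = 1) (hP : P = C * A * C⁻¹ * A) : A * P = P⁻¹ * A := by
  have hA' : A⁻¹ = A := inv_eq_of_mul_eq_one_left hA
  simp [hP, hA', mul_assoc]

theorem twist_swap_gen (hA : A * A = 1) (hP : P = C * A * C⁻¹ * A) :
    A * C = P⁻¹ * C * A := by
  have hA' : A⁻¹ = A := inv_eq_of_mul_eq_one_left hA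
  simp [hP, hA', hA, mul_assoc]

theorem twist_swap_gen_inv (hA : A * A = 1) (hP : P = C * A * C⁻¹ * A) :
    A * C⁻¹ = C⁻¹ * P * A := by
  simp [hP, hA, mul_assoc]

theorem twist_cube (hA : A * A = 1) (hC : C * C * C = 1) (hP : P = C * A * C⁻¹ * A) :
    P * C⁻¹ * P * C⁻¹ * P = C := by
  have hC' : C⁻¹ * C⁻¹ * C⁻¹ = 1 := by
    rw [← mul_inv_rev, ← mul_inv_rev, ← mul_assoc, hC, inv_one]
  have e : P = C * (A * C⁻¹ * A⁻¹) := by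
    rw [inv_eq_of_mul_eq_one_left hA, hP]; simp only [mul_assoc]
  have : P * C⁻¹ * P * C⁻¹ * P = C * A * (C⁻¹ * C⁻¹ * C⁻¹) * A⁻¹ := by
    rw [e]; group
  rw [this, hC']; group

/-- The elements of the orbit of `x`, up to powers of `T`. -/
def bigReps [DecidableEq X] (C P : G) (x : X) : Finset X :=
  {x, P • x, C • x, C • P • x, C⁻¹ • x, C⁻¹ • P • x}

/-- The orbit of a point fixed by `C` and `T`. -/
def smallReps [DecidableEq X] (A C P : G) (x : X) : Finset X :=
  {x, P • x, C • P • x, C⁻¹ • P • x} ∪ {A • x, A • P • x, A • C • P • x, A • C⁻¹ • P • x}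

theorem card_smallReps_le [DecidableEq X] (x : X) : (smallReps A C P x).card ≤ 8 :=
  (Finset.card_union_le _ _).trans (Nat.add_le_add Finset.card_le_four Finset.card_le_four)

theorem twist_sq_smul (hPP : P * P = T ^ n) (x : X) : P • P • x = T ^ n • x := by
  rw [smul_smul, hPP]

/-- `T ^ (3 * n)` fixes `x`. -/
theorem pow_three_mul_smul (hA : A * A = 1) (hC : C * C * C = 1) (hCT : Commute C T)
    (hAT : A * T = T⁻¹ * A) (hP : P = C * A * C⁻¹ * A) (hPP : P * P = T ^ n) {x : X}
    (hx : P • C • x = C • P • x) : T ^ (3 * n) • x = x := by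
  set u := T ^ n with hu
  have hPu : Commute P u := (commute_twist hCT hAT hP).pow_right n
  have hCu : Commute C u := hCT.pow_right n
  have cP (y : X) : P • u • y = u • P • y := by rw [smul_smul, hPu.eq, mul_smul]
  have cC (y : X) : C • u • y = u • C • y := by rw [smul_smul, hCu.eq, mul_smul]
  have cCi (y : X) : C⁻¹ • u • y = u • C⁻¹ • y := by
    rw [smul_smul, hCu.inv_left.eq, mul_smul]
  have hPP' (y : X) : P • P • y = u • y := twist_sq_smul hPP y
  have hC2 (y : X) : C • y = C⁻¹ • C⁻¹ • y := by
    rw [eq_inv_smul_iff, eq_inv_smul_iff, smul_smul, smul_smul, hC, one_smul]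
  have key (y : X) : P • C⁻¹ • P • C⁻¹ • P • y = C • y := by
    simp only [smul_smul, ← mul_assoc, twist_cube hA hC hP]
  have h1 : u • P • C⁻¹ • x = C⁻¹ • x := by
    have h := key (C • x)
    rw [hx, inv_smul_smul, hPP', cCi, cP, hC2 (C • x), inv_smul_smul] at h
    exact h
  have h2 : u • u • u • C⁻¹ • x = C⁻¹ • x := by
    rw [← hPP' (C⁻¹ • x), ← cP, h1, h1]
  rw [← cCi, ← cCi, ← cCi, smul_left_cancel_iff, ← mul_smul, ← mul_smul] at h2
  rw [mul_comm, pow_mul, ← hu, pow_succ, pow_two, h2]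

/-- The points `T ^ l • y` with `y` among the given representatives. -/
def bigOrbit [DecidableEq X] (C P T : G) (x : X) : Set X :=
  {z | ∃ l : ℤ, ∃ y ∈ bigReps C P x, z = T ^ l • y}

theorem smul_mem_bigOrbit_gen [DecidableEq X] (hC : C * C * C = 1) (hCT : Commute C T)
    {x z : X} (hz : z ∈ bigOrbit C P T x) : C • z ∈ bigOrbit C P T x := by
  obtain ⟨l, y, hy, rfl⟩ := hz
  have hC2 (y : X) : C • C • y = C⁻¹ • y := by
    rw [eq_inv_smul_iff, smul_smul, smul_smul, hC, one_smul]
  refine ⟨l, C • y, ?_, by rw [smul_smul, (hCT.zpow_right l).eq, mul_smul]⟩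
  simp only [bigReps, Finset.mem_insert, Finset.mem_singleton] at hy ⊢
  rcases hy with rfl | rfl | rfl | rfl | rfl | rfl <;> simp [hC2]

theorem smul_mem_bigOrbit_central [DecidableEq X] {x z : X} (m : ℤ)
    (hz : z ∈ bigOrbit C P T x) : T ^ m • z ∈ bigOrbit C P T x := by
  obtain ⟨l, y, hy, rfl⟩ := hz
  exact ⟨m + l, y, hy, by rw [smul_smul, zpow_add]⟩

theorem smul_zpow_of_flip (hAT : A * T = T⁻¹ * A) (l : ℤ) (y : X) :
    A • T ^ l • y = T ^ (-l) • A • y := by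
  have h : SemiconjBy A T T⁻¹ := hAT
  rw [smul_smul, (h.zpow_right l).eq, inv_zpow', mul_smul]

theorem smul_mem_bigOrbit_flip [DecidableEq X] (hA : A * A = 1)
    (hCT : Commute C T) (hAT : A * T = T⁻¹ * A) (hP : P = C * A * C⁻¹ * A)
    (hPP : P * P = T ^ n) {x z : X} (hAx : A • x = x) (hx : P • C • x = C • P • x)
    (hz : z ∈ bigOrbit C P T x) : A • z ∈ bigOrbit C P T x := by
  obtain ⟨l, y, hy, rfl⟩ := hz
  rw [smul_zpow_of_flip hAT]
  apply smul_mem_bigOrbit_central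
  have hPi (y : X) : P⁻¹ • y = T ^ (-n : ℤ) • P • y := by
    rw [inv_smul_eq_iff, zpow_neg, zpow_natCast, smul_smul,
      ((commute_twist hCT hAT hP).pow_right n).inv_right.eq, mul_smul, twist_sq_smul hPP,
      inv_smul_smul]
  have hAP (y : X) : A • P • y = P⁻¹ • A • y := by
    simp only [smul_smul, twist_swap hA hP]
  have hAC (y : X) : A • C • y = P⁻¹ • C • A • y := by
    simp only [smul_smul, twist_swap_gen hA hP, mul_assoc]
  have hACi (y : X) : A • C⁻¹ • y = C⁻¹ • P • A • y := by
    simp only [smul_smul, twist_swap_gen_inv hA hP, mul_assoc]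
  have hx' : P⁻¹ • C • x = C • P⁻¹ • x := by
    rw [inv_smul_eq_iff, hPi, smul_smul C, ((hCT.zpow_right _).eq), mul_smul, smul_smul P,
      ((commute_twist hCT hAT hP).zpow_right _).eq, mul_smul, ← hx, twist_sq_smul hPP,
      zpow_neg, zpow_natCast, inv_smul_smul]
  simp only [bigReps, Finset.mem_insert, Finset.mem_singleton] at hy
  rcases hy with rfl | rfl | rfl | rfl | rfl | rfl
  · exact ⟨0, y, by simp [bigReps], by rw [hAx, zpow_zero, one_smul]⟩
  · exact ⟨-n, P • x, by simp [bigReps], by rw [hAP, hAx, hPi]⟩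
  · exact ⟨-n, C • P • x, by simp [bigReps], by rw [hAC, hAx, hPi, hx]⟩
  · exact ⟨-n, C • x, by simp [bigReps], by
      rw [hAC, hAP, hAx, ← hx', hPi, smul_inv_smul]⟩
  · exact ⟨0, C⁻¹ • P • x, by simp [bigReps], by rw [hACi, hAx, zpow_zero, one_smul]⟩
  · exact ⟨0, C⁻¹ • x, by simp [bigReps], by
      rw [hACi, hAP, hAx, smul_inv_smul, zpow_zero, one_smul]⟩

theorem bigOrbit_finite_card [DecidableEq X] {x : X} {N : ℕ} (hN : 0 < N)
    (hCT : Commute C T) (hPT : Commute P T) (hx : T ^ N • x = x) :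
    (bigOrbit C P T x).Finite ∧ (bigOrbit C P T x).ncard ≤ N * 6 := by
  have hfix : ∀ y ∈ bigReps C P x, T ^ N • y = y := by
    have c1 (y : X) : T ^ N • C • y = C • T ^ N • y := by
      rw [smul_smul, ← (hCT.pow_right N).eq, mul_smul]
    have c2 (y : X) : T ^ N • P • y = P • T ^ N • y := by
      rw [smul_smul, ← (hPT.pow_right N).eq, mul_smul]
    have c3 (y : X) : T ^ N • C⁻¹ • y = C⁻¹ • T ^ N • y := by
      rw [smul_smul, ← (hCT.pow_right N).inv_left.eq, mul_smul]
    intro y hy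
    simp only [bigReps, Finset.mem_insert, Finset.mem_singleton] at hy
    rcases hy with rfl | rfl | rfl | rfl | rfl | rfl <;> simp only [c1, c2, c3, hx]
  have hsub : bigOrbit C P T x ⊆
      (Finset.image₂ (fun (l : ℕ) y => T ^ l • y) (Finset.range N) (bigReps C P x) : Set X) := by
    rintro _ ⟨l, y, hy, rfl⟩
    have hN' : (N : ℤ) ≠ 0 := by omega
    have h0 := Int.emod_nonneg l hN'
    refine Finset.mem_coe.2 (Finset.mem_image₂.2 ⟨(l % N).toNat, ?_, y, hy, ?_⟩)
    · have := Int.emod_lt_of_pos l (by omega : (0 : ℤ) < N)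
      rw [Finset.mem_range]
      omega
    · have hmem : T ^ N ∈ MulAction.stabilizer G y := hfix y hy
      have h1 : (T ^ N) ^ (l / N) • y = y := (MulAction.stabilizer G y).zpow_mem hmem _
      rw [← zpow_natCast, Int.toNat_of_nonneg h0]
      nth_rewrite 2 [← Int.emod_add_mul_ediv l N]
      rw [zpow_add, zpow_mul, zpow_natCast, mul_smul, h1]
  refine ⟨(Finset.finite_toSet _).subset hsub, ?_⟩
  refine (Set.ncard_le_ncard hsub (Finset.finite_toSet _)).trans ?_
  rw [Set.ncard_coe_finset]
  refine (Finset.card_image₂_le _ _ _).trans ?_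
  rw [Finset.card_range]
  exact Nat.mul_le_mul_left _ Finset.card_le_six

theorem smul_mem_smallReps [DecidableEq X] (hA : A * A = 1) (hC : C * C * C = 1)
    (hCT : Commute C T) (hAT : A * T = T⁻¹ * A) (hP : P = C * A * C⁻¹ * A)
    (hPP : P * P = T ^ n) {x : X} (hCx : C • x = x) (hTx : T • x = x) {z : X}
    (hz : z ∈ smallReps A C P x) :
    A • z ∈ smallReps A C P x ∧ C • z ∈ smallReps A C P x ∧ T • z = z := by
  have hPT : Commute P T := commute_twist hCT hAT hP
  have cP (y : X) : T • P • y = P • T • y := by rw [smul_smul, ← hPT.eq, mul_smul]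
  have cC (y : X) : T • C • y = C • T • y := by rw [smul_smul, ← hCT.eq, mul_smul]
  have cCi (y : X) : T • C⁻¹ • y = C⁻¹ • T • y := by
    rw [smul_smul, ← hCT.inv_left.eq, mul_smul]
  have cA (y : X) : T • A • y = A • T⁻¹ • y := by
    simpa using (smul_zpow_of_flip hAT (-1) y).symm
  have hC2 (y : X) : C • C • y = C⁻¹ • y := by
    rw [eq_inv_smul_iff, smul_smul, smul_smul, hC, one_smul]
  have hCix : C⁻¹ • x = x := by rw [inv_smul_eq_iff, hCx]
  have hAA (y : X) : A • A • y = y := by rw [smul_smul, hA, one_smul]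
  have hCA (y : X) : C • A • y = A • P⁻¹ • C • y := by
    have h : A * (P⁻¹ * C) = C * A := by simp [hP, inv_eq_of_mul_eq_one_left hA, mul_assoc,
      ← mul_assoc A A, hA]
    rw [smul_smul, ← h, mul_smul, mul_smul]
  have hT' {y : X} (h : T • y = y) : P • P • y = y := by
    have : T ^ n ∈ MulAction.stabilizer G y := (MulAction.stabilizer G y).pow_mem h n
    rw [twist_sq_smul hPP]; exact this
  have hPi {y : X} (h : T • y = y) : P⁻¹ • y = P • y := by
    rw [inv_smul_eq_iff, hT' h]
  have h1 : P • x = P⁻¹ • x := (hPi hTx).symm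
  have h3 : P • C⁻¹ • P • x = C • P • x := by
    have h : P • C⁻¹ • P • C⁻¹ • P • P • x = C • P • x := by
      simp only [smul_smul, ← mul_assoc, twist_cube hA hC hP]
    rwa [hT' hTx, hCix] at h
  have h4 : P⁻¹ • C • P • x = C⁻¹ • P • x := by rw [inv_smul_eq_iff, h3]
  have h5 : P⁻¹ • C⁻¹ • P • x = C • P • x := by
    rw [hPi (by rw [cCi, cP, hTx]), h3]
  have hTz (y : X) (hy : y = x ∨ y = P • x ∨ y = C • P • x ∨ y = C⁻¹ • P • x) :
      T • y = y := by
    rcases hy with rfl | rfl | rfl | rfl <;> simp only [cP, cC, cCi, hTx]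
  have hTA {y : X} (h : T • y = y) : T • A • y = A • y := by
    rw [cA, inv_smul_eq_iff.2 h.symm]
  simp only [smallReps, Finset.mem_union, Finset.mem_insert, Finset.mem_singleton] at hz ⊢
  rcases hz with (rfl | rfl | rfl | rfl) | (rfl | rfl | rfl | rfl)
  · simp [hCx, hTx]
  · simp [hTz]
  · simp [hTz, hC2]
  · simp [hTz]
  · simp [hAA, hCA, hCx, hTA, hTx, ← h1]
  · simp [hAA, hCA, h4, hTA, hTz]
  · simp [hAA, hCA, hC2, h5, hTA, hTz]
  · simp [hAA, hCA, hTA, hTz]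

end GroupAction

namespace LinkQuandle

variable {Q : Type*} (q : LinkQuandle Q)

/-- Right translation by `y`, as a permutation. -/
def translation (y : Q) : Equiv.Perm Q where
  toFun x := q.op x y
  invFun x := q.inv x y
  left_inv x := q.inv_op x y
  right_inv x := q.op_inv x y

theorem translation_op (x y : Q) :
    q.translation (q.op x y) = q.translation y * q.translation x * (q.translation y)⁻¹ := by
  ext z
  change q.op z (q.op x y) = q.op (q.op (q.inv z y) x) y
  rw [q.distrib, q.op_inv]

/-- The permutations compatible with translations. -/
def autSubgroup : Subgroup (Equiv.Perm Q) where
  carrier := {g | ∀ x, q.translation (g • x) = g * q.translation x * g⁻¹}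
  one_mem' x := by simp
  mul_mem' {g h} hg hh x := by
    rw [mul_smul, hg, hh]; group
  inv_mem' {g} hg x := by
    have h := hg (g⁻¹ • x)
    rw [smul_inv_smul] at h
    rw [h]; group

theorem translation_mem (y : Q) : q.translation y ∈ q.autSubgroup :=
  fun x => q.translation_op x y

theorem pairPow_eq (y z x : Q) (t : ℕ) :
    q.pairPow y z t x = (q.translation z * q.translation y) ^ t • x := by
  induction t with
  | zero => rfl
  | succ t ih =>
    rw [pow_succ', mul_smul, ← ih, pairPow, pairPow, Function.iterate_succ_apply']
    rfl

end LinkQuandle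

theorem stmt17 {Q : Type*} (q : LinkQuandle Q) (a b c : Q) (k : ℕ) (hk : 1 ≤ k)
    (h1 : q.op (q.op c b) a = c)
    (h2 : q.op (q.inv (q.op (q.op a c) a) c) a = q.op (q.op (q.inv a c) a) c)
    (h3 : q.op (q.op (q.inv a c) a) c = q.pairPow a b (k - 1) b)
    (ha : ∀ x : Q, q.op (q.op x a) a = x)
    (hb : ∀ x : Q, q.op (q.op x b) b = x)
    (hc : ∀ x : Q, q.op (q.op (q.op x c) c) c = x) :
    (q.genClosure {a, b, c}).Finite ∧
    (q.genClosure {a, b, c}).ncard ≤ 18 * (2 * k - 1) + 8 := by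
  classical
  set A := q.translation a with hAdef
  set B := q.translation b with hBdef
  set C := q.translation c with hCdef
  set T := B * A with hTdef
  set P := C * A * C⁻¹ * A with hP
  have hA : A * A = 1 := Equiv.ext ha
  have hB : B * B = 1 := Equiv.ext hb
  have hC : C * C * C = 1 := Equiv.ext hc
  have hA' : A⁻¹ = A := inv_eq_of_mul_eq_one_left hA
  have hB' : B⁻¹ = B := inv_eq_of_mul_eq_one_left hB
  have hTinv : T⁻¹ = A * B := by rw [hTdef, mul_inv_rev, hA', hB']
  have hAm : A ∈ q.autSubgroup := q.translation_mem a
  have hBm : B ∈ q.autSubgroup := q.translation_mem b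
  have hCm : C ∈ q.autSubgroup := q.translation_mem c
  have hAT : A * T = T⁻¹ * A := by rw [hTinv, hTdef, mul_assoc]
  have hTB : B = T * A := by rw [hTdef, mul_assoc, hA, mul_one]
  have hTc' : (A * B) • c = c := h1
  have hTc : T • c = c := by rw [← hTinv, inv_smul_eq_iff] at hTc'; exact hTc'.symm
  have hCT : Commute C T := by
    have h := (q.autSubgroup.mul_mem hBm hAm) c
    rw [← hTdef, hTc, eq_mul_inv_iff_mul_eq] at h
    exact h
  have h3' : (C * A * C⁻¹) • a = T ^ (k - 1) • b := by
    rw [hTdef, ← q.pairPow_eq, ← h3]; rfl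
  have hTm : T ∈ q.autSubgroup := q.autSubgroup.mul_mem hBm hAm
  have hPP : P * P = T ^ (2 * k - 1) := by
    have e1 := (q.autSubgroup.mul_mem (q.autSubgroup.mul_mem hCm hAm)
      (q.autSubgroup.inv_mem hCm)) a
    have e2 := (q.autSubgroup.pow_mem hTm (k - 1)) b
    rw [h3', e2] at e1
    have hBT : B * (T ^ (k - 1))⁻¹ = T ^ (k - 1) * B := by
      have h : SemiconjBy B T⁻¹ T := by
        change B * T⁻¹ = T * B
        rw [hTinv, hTdef, mul_assoc]
      rw [← inv_pow]
      exact h.pow_right _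
    have e3 : P * P = C * A * C⁻¹ * A * (C * A * C⁻¹)⁻¹ * A := by
      rw [hP]; simp only [mul_inv_rev, inv_inv, hA', mul_assoc]
    change _ = C * A * C⁻¹ * A * (C * A * C⁻¹)⁻¹ at e1
    change T ^ (k - 1) * B * (T ^ (k - 1))⁻¹ = _ at e1
    rw [e3, ← e1, mul_assoc (T ^ (k - 1)), hBT, hTB, mul_assoc, mul_assoc, mul_assoc, hA, mul_one,
      ← pow_succ, ← pow_add]
    congr 1
    omega
  have hAa : A • a = a := q.idem a
  have hCc : C • c = c := q.idem c
  have hPCa : P • C • a = C • P • a := by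
    have h : (A * C⁻¹ * A * C) • a = (C * A * C⁻¹) • a := h2
    have e1 : P • a = (C * A * C⁻¹) • a := by rw [hP, mul_smul _ A, hAa]
    have e2 : C⁻¹ • P • C • a = (A * C⁻¹ * A * C) • a := by
      simp only [hP, smul_smul, mul_assoc, inv_mul_cancel_left]
    rw [← inv_smul_eq_iff, e2, h, e1]
  have hba : b = T ^ (-(k - 1 : ℕ) : ℤ) • P • a := by
    rw [zpow_neg, zpow_natCast, eq_inv_smul_iff, ← h3', hP, mul_smul _ A, hAa]
  have hPT : Commute P T := commute_twist hCT hAT hP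
  have hfix := pow_three_mul_smul hA hC hCT hAT hP hPP hPCa
  obtain ⟨hfin, hcard⟩ := bigOrbit_finite_card (by omega) hCT hPT hfix
  have hclosed : ∀ x ∈ bigOrbit C P T a ∪ (smallReps A C P c : Set Q),
      A • x ∈ bigOrbit C P T a ∪ (smallReps A C P c : Set Q) ∧
      C • x ∈ bigOrbit C P T a ∪ (smallReps A C P c : Set Q) ∧
      T • x ∈ bigOrbit C P T a ∪ (smallReps A C P c : Set Q) := by
    rintro x (hx | hx)
    · refine ⟨.inl (smul_mem_bigOrbit_flip hA hCT hAT hP hPP hAa hPCa hx),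
        .inl (smul_mem_bigOrbit_gen hC hCT hx), .inl ?_⟩
      simpa using smul_mem_bigOrbit_central 1 hx
    · obtain ⟨h1, h2, h3⟩ := smul_mem_smallReps hA hC hCT hAT hP hPP hCc hTc hx
      exact ⟨.inr h1, .inr h2, .inr (h3.symm ▸ hx)⟩
  have hsub : q.genClosure {a, b, c} ⊆ bigOrbit C P T a ∪ (smallReps A C P c : Set Q) := by
    refine Set.sInter_subset_of_mem ⟨?_, ?_⟩
    · rintro x (rfl | rfl | rfl)
      · exact .inl ⟨0, _, Finset.mem_insert_self _ _, by simp⟩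
      · exact .inl ⟨_, _, by simp [bigReps], hba⟩
      · exact .inr (by simp [smallReps])
    · rintro x hx s (rfl | rfl | rfl)
      · refine ⟨(hclosed x hx).1, ?_⟩
        change A⁻¹ • x ∈ _
        rw [hA']
        exact (hclosed x hx).1
      · have h : B • x ∈ bigOrbit C P T a ∪ (smallReps A C P c : Set Q) := by
          rw [hTB, mul_smul]
          exact (hclosed _ (hclosed x hx).1).2.2
        refine ⟨h, ?_⟩
        change B⁻¹ • x ∈ _
        rwa [hB']
      · refine ⟨(hclosed x hx).2.1, ?_⟩
        change C⁻¹ • x ∈ _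
        rw [inv_eq_of_mul_eq_one_left hC, mul_smul]
        exact (hclosed _ (hclosed x hx).2.1).2.1
  have hfin' := hfin.union (smallReps A C P c).finite_toSet
  refine ⟨hfin'.subset hsub, (Set.ncard_le_ncard hsub hfin').trans ?_⟩
  refine (Set.ncard_union_le _ _).trans ?_
  rw [Set.ncard_coe_finset]
  have := card_smallReps_le (A := A) (C := C) (P := P) c
  omega
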